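/- (Dedekind eta inversion) For τ in the upper half-plane, η(−1/τ) = √(τ/i) · η(τ), where η(τ) = e^{πiτ/12} ∏_{m≥1} (1 − e^{2πimτ}) and √(τ/i) is the branch of the square root taking the value 1 at τ = i. -/

import Mathlib

open Complex Real

/-- The Dedekind eta function `η(τ) = e^{πiτ/12} ∏_{m≥1} (1 − e^{2πimτ})`. -/
noncomputable def dedekindEta (τ : ℂ) : ℂ :=
  Complex.exp (π * I * τ / 12) * ∏' m : ℕ, (1 - Complex.exp (2 * π * I * ((m : ℂ) + 1) * τ))

theorem dedekindEta_eq_eta (τ : ℂ) : dedekindEta τ = ModularForm.eta τ := by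
  simp only [dedekindEta, ModularForm.eta, ModularForm.eta_q_eq_cexp, Function.Periodic.qParam]
  congr 2
  push_cast
  ring

theorem div_I_cpow_of_im_pos {τ : ℂ} (hτ : 0 < τ.im) (s : ℂ) :
    (τ / I) ^ s = (I ^ s)⁻¹ * τ ^ s := by
  have h0 : τ ≠ 0 := by rintro rfl; simp at hτ
  have hdiv : τ / I ≠ 0 := div_ne_zero h0 I_ne_zero
  have harg : |(τ / I).arg| < π / 2 := abs_arg_lt_pi_div_two_iff.mpr (.inl (by simpa using hτ))
  have hlog : Complex.log τ = Complex.log I + Complex.log (τ / I) := by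
    rw [← Complex.log_mul I_ne_zero hdiv, mul_div_cancel₀ _ I_ne_zero]
    simp only [arg_I, Set.mem_Ioc]
    constructor <;> linarith [abs_lt.mp harg, Real.pi_pos]
  rw [cpow_def_of_ne_zero hdiv, cpow_def_of_ne_zero I_ne_zero, cpow_def_of_ne_zero h0, hlog,
    add_mul, Complex.exp_add, inv_mul_cancel_left₀ (Complex.exp_ne_zero _)]

/-- The inversion formula `η(−1/τ) = √(τ/i) η(τ)`, where `√(τ/i)` is the branch of the
square root taking the value `1` at `τ = i` (the principal branch, since `Re(τ/i) > 0`). -/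
theorem dedekindEta_inversion (τ : ℂ) (hτ : 0 < τ.im) :
    dedekindEta (-1 / τ) = (τ / I) ^ ((1 : ℂ) / 2) * dedekindEta τ := by
  have h := ModularForm.eta_comp_eq_csqrt_I_inv hτ
  simp only [Function.comp_apply, Pi.smul_apply, Pi.mul_apply, smul_eq_mul, Complex.sqrt] at h
  rw [dedekindEta_eq_eta, dedekindEta_eq_eta, div_I_cpow_of_im_pos hτ, h, mul_assoc, one_div]
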